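/- If G is a finite group which is not an elementary abelian 2-group, then |G| ≤ 8(|G| − c(G)), with equality if and only if G ≅ D₈ × C₂ⁿ for some non-negative integer n. -/

import Mathlib

open scoped Classical

/-- The number of cyclic subgroups of a group. -/
noncomputable def numCyclic (G : Type*) [Group G] : ℕ :=
  Nat.card {H : Subgroup G // IsCyclic (↥H)}

/-- `alpha G = c(G) / |G|`, the number of cyclic subgroups divided by the order. -/
noncomputable def alpha (G : Type*) [Group G] : ℚ :=
  (numCyclic G : ℚ) / (Nat.card G : ℚ)

section CyclicCount

variable {G : Type*} [Group G]

theorem eq_one_or_eq_of_mem_zpowers {g x : G} (hg : g ^ 2 = 1) (hx : x ∈ Subgroup.zpowers g) :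
    x = 1 ∨ x = g := by
  obtain ⟨k, rfl⟩ := Subgroup.mem_zpowers_iff.1 hx
  have hz : g ^ (2 : ℤ) = 1 := by exact_mod_cast hg
  obtain ⟨m, hm | hm⟩ := Int.even_or_odd' k
  · left; rw [hm, zpow_mul, hz, one_zpow]
  · right; rw [hm, zpow_add, zpow_mul, hz, one_zpow, one_mul, zpow_one]

theorem eq_of_zpowers_eq_of_sq_eq_one {g x : G} (hg : g ^ 2 = 1)
    (hx : Subgroup.zpowers x = Subgroup.zpowers g) : x = g := by
  rcases eq_one_or_eq_of_mem_zpowers hg (hx ▸ Subgroup.mem_zpowers x) with rfl | rfl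
  · rw [Subgroup.zpowers_one_eq_bot, eq_comm, Subgroup.zpowers_eq_bot] at hx
    exact hx.symm
  · rfl

theorem eq_or_eq_inv_of_zpowers_eq {g x : G} (hg : g ^ 4 = 1)
    (hx : Subgroup.zpowers x = Subgroup.zpowers g) : x = g ∨ x = g⁻¹ := by
  obtain ⟨k, hk⟩ := Subgroup.mem_zpowers_iff.1 (hx ▸ Subgroup.mem_zpowers x)
  have hz : g ^ (4 : ℤ) = 1 := by exact_mod_cast hg
  obtain ⟨m, hm | hm⟩ := Int.even_or_odd' k
  · have hx2 : x ^ 2 = 1 := by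
      rw [← hk, ← zpow_natCast, ← zpow_mul, hm,
        show 2 * m * ((2 : ℕ) : ℤ) = 4 * m by push_cast; ring, zpow_mul, hz, one_zpow]
    exact .inl (eq_of_zpowers_eq_of_sq_eq_one hx2 hx.symm).symm
  · obtain ⟨l, hl | hl⟩ := Int.even_or_odd' m
    · left
      rw [← hk, hm, hl, show 2 * (2 * l) + 1 = 4 * l + 1 by ring, zpow_add, zpow_mul, hz,
        one_zpow, one_mul, zpow_one]
    · right
      rw [← hk, hm, hl, show 2 * (2 * l + 1) + 1 = 4 * (l + 1) + (-1) by ring, zpow_add, zpow_mul,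
        hz, one_zpow, one_mul, zpow_neg_one]

/-- The number of solutions of `g ^ 2 = 1`. -/
noncomputable def numSqOne (G : Type*) [Group G] : ℕ := Nat.card {g : G // g ^ 2 = 1}

/-- The cyclic subgroup generated by an element. -/
def toCyclic (g : G) : {H : Subgroup G // IsCyclic H} :=
  ⟨Subgroup.zpowers g, inferInstance⟩

theorem toCyclic_surjective : Function.Surjective (toCyclic (G := G)) := by
  rintro ⟨H, hH⟩
  obtain ⟨g, rfl⟩ := (Subgroup.isCyclic_iff_exists_zpowers_eq_top H).1 hH
  exact ⟨g, rfl⟩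

theorem toCyclic_eq_iff {g x : G} :
    toCyclic x = toCyclic g ↔ Subgroup.zpowers x = Subgroup.zpowers g := Subtype.ext_iff

theorem numSqOne_eq_card [Fintype G] :
    numSqOne G = (Finset.univ.filter fun g : G => g ^ 2 = 1).card := by
  rw [numSqOne, Nat.card_eq_fintype_card, Fintype.card_subtype]

theorem card_add_numSqOne_eq_sum [Fintype G] [Fintype {H : Subgroup G // IsCyclic H}] :
    Nat.card G + numSqOne G = ∑ C : {H : Subgroup G // IsCyclic H},
      ∑ g ∈ Finset.univ.filter (fun g : G => toCyclic g = C), (1 + if g ^ 2 = 1 then 1 else 0) := by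
  rw [Finset.sum_fiberwise, Finset.sum_add_distrib, numSqOne_eq_card, Finset.card_filter]
  simp

theorem two_mul_numCyclic_le [Fintype G] : 2 * numCyclic G ≤ Nat.card G + numSqOne G := by
  have : Fintype {H : Subgroup G // IsCyclic H} := Fintype.ofFinite _
  rw [card_add_numSqOne_eq_sum, numCyclic, Nat.card_eq_fintype_card, mul_comm, ← smul_eq_mul,
    ← Finset.card_univ, ← Finset.sum_const]
  refine Finset.sum_le_sum fun C _ => ?_
  obtain ⟨g, rfl⟩ := toCyclic_surjective C
  by_cases hg : g ^ 2 = 1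
  · calc 2 = ∑ x ∈ {g}, (1 + if x ^ 2 = 1 then 1 else 0) := by simp [hg]
      _ ≤ _ := Finset.sum_le_sum_of_subset (by simp)
  · have hne : g ≠ g⁻¹ := fun h => hg (by rw [pow_two]; exact mul_eq_one_iff_eq_inv.2 h)
    calc 2 = ∑ x ∈ {g, g⁻¹}, 1 := by simp [Finset.card_pair hne]
      _ ≤ ∑ x ∈ {g, g⁻¹}, (1 + if x ^ 2 = 1 then 1 else 0) :=
        Finset.sum_le_sum fun _ _ => Nat.le_add_right _ _
      _ ≤ _ := Finset.sum_le_sum_of_subset (by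
        intro x hx
        rw [Finset.mem_insert, Finset.mem_singleton] at hx
        rcases hx with rfl | rfl <;> simp [toCyclic_eq_iff])

theorem two_mul_numCyclic_eq [Fintype G] (h4 : ∀ g : G, g ^ 4 = 1) :
    2 * numCyclic G = Nat.card G + numSqOne G := by
  refine le_antisymm two_mul_numCyclic_le ?_
  have : Fintype {H : Subgroup G // IsCyclic H} := Fintype.ofFinite _
  rw [card_add_numSqOne_eq_sum, numCyclic, Nat.card_eq_fintype_card, mul_comm 2, ← smul_eq_mul,
    ← Finset.card_univ, ← Finset.sum_const]
  refine Finset.sum_le_sum fun C _ => ?_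
  obtain ⟨g, rfl⟩ := toCyclic_surjective C
  by_cases hg : g ^ 2 = 1
  · calc _ ≤ ∑ x ∈ {g}, (1 + if x ^ 2 = 1 then 1 else 0) :=
        Finset.sum_le_sum_of_subset (by
          intro x hx
          rw [Finset.mem_filter, toCyclic_eq_iff] at hx
          exact Finset.mem_singleton.2 (eq_of_zpowers_eq_of_sq_eq_one hg hx.2))
      _ = 2 := by simp [hg]
  · calc _ ≤ ∑ x ∈ {g, g⁻¹}, (1 + if x ^ 2 = 1 then 1 else 0) :=
        Finset.sum_le_sum_of_subset (by
          intro x hx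
          rw [Finset.mem_filter, toCyclic_eq_iff] at hx
          simpa using eq_or_eq_inv_of_zpowers_eq (h4 g) hx.2)
      _ = ∑ x ∈ {g, g⁻¹}, 1 := by
        refine Finset.sum_congr rfl fun x hx => ?_
        rw [Finset.mem_insert, Finset.mem_singleton] at hx
        rcases hx with rfl | rfl <;> simp [hg]
      _ ≤ 2 := by
        rw [← Finset.card_eq_sum_ones]; exact Finset.card_le_two

end CyclicCount

section Involutions

variable {G : Type*} [Group G]

theorem commute_of_sq_eq_one {x y : G} (hx : x ^ 2 = 1) (hy : y ^ 2 = 1) (hxy : (x * y) ^ 2 = 1) :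
    Commute x y := by
  have hi : ∀ {u : G}, u ^ 2 = 1 → u⁻¹ = u := fun hu =>
    inv_eq_of_mul_eq_one_left (by rwa [← pow_two])
  have := hi hxy
  rw [mul_inv_rev, hi hx, hi hy] at this
  exact this.symm

theorem two_mul_numSqOne_le [Fintype G] (x : G) :
    2 * numSqOne G ≤ Nat.card G +
      (Finset.univ.filter fun y : G => y ^ 2 = 1 ∧ (x * y) ^ 2 = 1).card := by
  set S := Finset.univ.filter fun g : G => g ^ 2 = 1 with hS
  set T := Finset.univ.filter fun g : G => (x * g) ^ 2 = 1 with hT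
  have hTS : T.card = S.card := by
    refine Finset.card_bij (fun g _ => x * g) ?_ ?_ ?_
    · simp [hS, hT]
    · simp
    · intro b hb
      exact ⟨x⁻¹ * b, by simpa [hS, hT] using hb, by simp⟩
  have h1 := Finset.card_union_add_card_inter S T
  have h2 : (S ∪ T).card ≤ Nat.card G := by
    rw [Nat.card_eq_fintype_card]; exact Finset.card_le_univ _
  rw [numSqOne_eq_card, ← hS, Finset.filter_and, ← hS, ← hT]
  omega

theorem filter_sq_eq_one_subset_centralizer [Fintype G] {x : G} (hx : x ^ 2 = 1) :
    (Finset.univ.filter fun y : G => y ^ 2 = 1 ∧ (x * y) ^ 2 = 1) ⊆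
      Finset.univ.filter fun y : G => y ∈ Subgroup.centralizer {x} := by
  intro y hy
  simp only [Finset.mem_filter, Finset.mem_univ, true_and] at hy ⊢
  exact Subgroup.mem_centralizer_singleton_iff.2 (commute_of_sq_eq_one hx hy.1 hy.2).symm

theorem card_filter_mem_subgroup [Fintype G] (H : Subgroup G) :
    (Finset.univ.filter fun y : G => y ∈ H).card = Nat.card H := by
  rw [Nat.card_eq_fintype_card]
  exact (Fintype.card_subtype _).symm

theorem Subgroup.two_mul_card_le_of_ne_top [Finite G] {H : Subgroup G} (hH : H ≠ ⊤) :
    2 * Nat.card H ≤ Nat.card G := by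
  rw [← H.card_mul_index, mul_comm]
  exact Nat.mul_le_mul_left _ (by
    have := H.index_ne_zero_of_finite
    have : H.index ≠ 1 := fun h => hH (Subgroup.index_eq_one.1 h)
    omega)

theorem sq_eq_one_of_forall_mem_center [Fintype G] (hI : Nat.card G < 2 * numSqOne G)
    (hc : ∀ x : G, x ^ 2 = 1 → x ∈ Subgroup.center G) (g : G) : g ^ 2 = 1 := by
  let H : Subgroup G :=
    { carrier := {x | x ^ 2 = 1}
      one_mem' := one_pow 2
      mul_mem' := fun {a b} ha hb => by
        have hab : Commute a b := (Subgroup.mem_center_iff.1 (hc b hb) a)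
        change (a * b) ^ 2 = 1
        rw [hab.mul_pow, ha, hb, one_mul]
      inv_mem' := fun {a} ha => by
        change a⁻¹ ^ 2 = 1
        rw [inv_pow, ha, inv_one] }
  have hH : H = ⊤ := by
    by_contra hne
    have h1 := Subgroup.two_mul_card_le_of_ne_top hne
    have h2 : Nat.card H = numSqOne G := rfl
    omega
  have : g ∈ H := hH ▸ Subgroup.mem_top g
  exact this

theorem mem_center_of_centralizer_eq_top {x : G} (h : Subgroup.centralizer {x} = ⊤) :
    x ∈ Subgroup.center G :=
  Subgroup.mem_center_iff.2 fun g =>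
    Subgroup.mem_centralizer_singleton_iff.1 (h ▸ Subgroup.mem_top g)

theorem four_mul_numSqOne_le [Fintype G] (h : ¬ ∀ g : G, g ^ 2 = 1) :
    4 * numSqOne G ≤ 3 * Nat.card G := by
  by_contra! hlt
  refine h (sq_eq_one_of_forall_mem_center (by omega) fun x hx => ?_)
  apply mem_center_of_centralizer_eq_top
  by_contra hne
  have h1 := Subgroup.two_mul_card_le_of_ne_top hne
  have h2 := two_mul_numSqOne_le x
  have h3 := Finset.card_le_card (filter_sq_eq_one_subset_centralizer hx)
  rw [card_filter_mem_subgroup] at h3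
  omega

theorem centralizer_of_four_mul_numSqOne_eq [Fintype G] (h : 4 * numSqOne G = 3 * Nat.card G)
    {x : G} (hx : x ^ 2 = 1) (hne : Subgroup.centralizer {x} ≠ ⊤) :
    (Subgroup.centralizer {x}).index = 2 ∧ ∀ y ∈ Subgroup.centralizer {x}, y ^ 2 = 1 := by
  have h1 := Subgroup.two_mul_card_le_of_ne_top hne
  have h2 := two_mul_numSqOne_le x
  have h3 := Finset.card_le_card (filter_sq_eq_one_subset_centralizer hx)
  rw [card_filter_mem_subgroup] at h3
  constructor
  · have h4 := (Subgroup.centralizer {x}).card_mul_index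
    have h5 : 0 < Nat.card (Subgroup.centralizer {x}) := Nat.card_pos
    refine Nat.eq_of_mul_eq_mul_left h5 ?_
    omega
  · intro y hy
    have heq := Finset.eq_of_subset_of_card_le (filter_sq_eq_one_subset_centralizer hx)
      (by rw [card_filter_mem_subgroup]; omega)
    have hy' : y ∈ Finset.univ.filter fun y : G => y ∈ Subgroup.centralizer {x} := by simpa using hy
    rw [← heq] at hy'
    exact (Finset.mem_filter.1 hy').2.1

end Involutions

section Dihedral

/-- The homomorphism from a dihedral group determined by the images of `r 1` and `sr 0`. -/
theorem DihedralGroup.exists_hom {G : Type*} [Group G] {n : ℕ} {a s : G} (ha : a ^ n = 1)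
    (hs : s * s = 1) (hsa : s * a * s = a⁻¹) :
    ∃ f : DihedralGroup n →* G,
      ∀ k : ℤ, f (.r k) = a ^ k ∧ f (.sr k) = s * a ^ k := by
  let ρ : ZMod n →+ Additive G :=
    ZMod.lift n ⟨zmultiplesHom (Additive G) (Additive.ofMul a), by
      simp [← ofMul_pow, ha]⟩
  have hρ (k : ℤ) : (ρ k).toMul = a ^ k := by simp [ρ]
  have hconj (k : ℤ) : a ^ k * s = s * a ^ (-k) := by
    have h0 : SemiconjBy s a a⁻¹ := by
      rw [SemiconjBy, ← hsa, mul_assoc, hs, mul_one]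
    have h1 := h0.zpow_right (-k)
    rw [SemiconjBy, inv_zpow, zpow_neg, inv_inv] at h1
    rw [zpow_neg, h1]
  let F : DihedralGroup n → G
    | .r i => (ρ i).toMul
    | .sr i => s * (ρ i).toMul
  refine ⟨⟨⟨F, ?_⟩, ?_⟩, fun k => ⟨hρ k, congrArg (s * ·) (hρ k)⟩⟩
  · exact congrArg Additive.toMul ρ.map_zero
  · rintro (i | i) (j | j) <;> obtain ⟨i, rfl⟩ := ZMod.intCast_surjective i <;>
      obtain ⟨j, rfl⟩ := ZMod.intCast_surjective j
    · simp only [DihedralGroup.r_mul_r, F, ← Int.cast_add, hρ, zpow_add]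
    · simp only [DihedralGroup.r_mul_sr, F, ← Int.cast_sub, hρ]
      rw [← mul_assoc, hconj, mul_assoc, ← zpow_add, sub_eq_neg_add]
    · simp only [DihedralGroup.sr_mul_r, F, ← Int.cast_add, hρ, zpow_add, mul_assoc]
    · simp only [DihedralGroup.sr_mul_sr, F, ← Int.cast_sub, hρ]
      rw [mul_assoc, ← mul_assoc _ s, hconj, mul_assoc, ← mul_assoc s s, hs, one_mul, ← zpow_add,
        sub_eq_neg_add]

end Dihedral

section ElementaryAbelian

theorem exists_mulEquiv_pi_of_sq_eq_one {E : Type*} [Group E] [Finite E] (h : ∀ e : E, e ^ 2 = 1) :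
    ∃ n : ℕ, Nonempty (E ≃* (Fin n → Multiplicative (ZMod 2))) := by
  let _ : CommGroup E := { ‹Group E› with
    mul_comm := fun a b => commute_of_sq_eq_one (h a) (h b) (h _) }
  let _ : Module (ZMod 2) (Additive E) :=
    AddCommGroup.zmodModule (n := 2) fun x => congrArg Additive.ofMul (h x.toMul)
  let b := (Module.finBasis (ZMod 2) (Additive E)).equivFun
  exact ⟨_, ⟨{
    toFun := fun e i => Multiplicative.ofAdd (b (Additive.ofMul e) i)
    invFun := fun v => (b.symm fun i => (v i).toAdd).toMul
    left_inv := fun e => by simp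
    right_inv := fun v => by ext; simp
    map_mul' := fun x y => by ext; simp }⟩⟩

theorem exists_subgroup_complement_of_sq_eq_one {B : Type*} [Group B] (h : ∀ b : B, b ^ 2 = 1)
    {z : B} (hz : z ≠ 1) : ∃ E : Subgroup B, z ∉ E ∧ ∀ b, b ∈ E ∨ z * b ∈ E := by
  let _ : CommGroup B := { ‹Group B› with
    mul_comm := fun a b => commute_of_sq_eq_one (h a) (h b) (h _) }
  let _ : Module (ZMod 2) (Additive B) :=
    AddCommGroup.zmodModule (n := 2) fun x => congrArg Additive.ofMul (h x.toMul)
  obtain ⟨f, hf1⟩ : ∃ f : Module.Dual (ZMod 2) (Additive B), f (Additive.ofMul z) ≠ 0 := by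
    by_contra! hf
    exact hz ((Module.forall_dual_apply_eq_zero_iff (ZMod 2) (Additive.ofMul z)).1 hf)
  refine ⟨(AddMonoidHom.toMultiplicativeRight f.toAddMonoidHom).ker, hf1, fun b => ?_⟩
  have key : ∀ u v : ZMod 2, u ≠ 0 → v = 0 ∨ u + v = 0 := by decide
  rcases key _ (f (Additive.ofMul b)) hf1 with h0 | h0
  · exact .inl h0
  · refine .inr ?_
    rw [← map_add] at h0
    exact h0

end ElementaryAbelian
section Main

theorem numSqOne_congr {G H : Type*} [Group G] [Group H] (e : G ≃* H) :
    numSqOne G = numSqOne H :=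
  Nat.card_congr (e.toEquiv.subtypeEquiv fun g => by simp [← map_pow])

theorem numSqOne_prod (G H : Type*) [Group G] [Group H] :
    numSqOne (G × H) = numSqOne G * numSqOne H := by
  rw [numSqOne, numSqOne, numSqOne, ← Nat.card_prod]
  exact Nat.card_congr
    ((Equiv.subtypeEquivRight fun p => by simp [Prod.ext_iff]).trans Equiv.subtypeProdEquivProd)

theorem numSqOne_eq_card_of_forall {G : Type*} [Group G] (h : ∀ g : G, g ^ 2 = 1) :
    numSqOne G = Nat.card G :=
  Nat.card_congr (Equiv.subtypeUnivEquiv h)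

theorem numSqOne_dihedralGroup_four : numSqOne (DihedralGroup 4) = 6 := by
  have h : (Finset.univ.filter fun g : DihedralGroup 4 => g * g = 1).card = 6 := by
    convert (by decide : (@Finset.filter (DihedralGroup 4) (fun g => g * g = 1)
      (fun g => instDecidableEqDihedralGroup _ _) Finset.univ).card = 6)
  rw [numSqOne_eq_card]
  simpa only [pow_two] using h

theorem multiplicative_zmod_two_sq {n : ℕ} (v : Fin n → Multiplicative (ZMod 2)) : v ^ 2 = 1 := by
  ext i
  exact (by decide : ∀ u : ZMod 2, 2 • u = 0) (v i).toAdd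

theorem dihedralGroup_four_pow_four (d : DihedralGroup 4) : d ^ 4 = 1 := by
  revert d
  decide

theorem exists_mulEquiv_dihedral_of_centralizer {G : Type*} [Group G] [Finite G] {x t : G}
    (hxt : ¬ Commute x t) (hx : x ^ 2 = 1) (ht : t ^ 2 = 1)
    (hX : (Subgroup.centralizer {x}).index = 2) (hT : (Subgroup.centralizer {t}).index = 2)
    (hX2 : ∀ y ∈ Subgroup.centralizer {x}, y ^ 2 = 1) :
    ∃ n : ℕ, Nonempty (G ≃* DihedralGroup 4 × (Fin n → Multiplicative (ZMod 2))) := by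
  set X := Subgroup.centralizer {x} with hXdef
  set T := Subgroup.centralizer {t} with hTdef
  have memX {g : G} : g ∈ X ↔ g * x = x * g := Subgroup.mem_centralizer_singleton_iff
  have memT {g : G} : g ∈ T ↔ g * t = t * g := Subgroup.mem_centralizer_singleton_iff
  have hxX : x ∈ X := memX.2 rfl
  have htT : t ∈ T := memT.2 rfl
  have hxT : x ∉ T := fun h => hxt (memT.1 h)
  have htX : t ∉ X := fun h => hxt (memX.1 h).symm
  have mulX {g h : G} : g * h ∈ X ↔ (g ∈ X ↔ h ∈ X) := Subgroup.mul_mem_iff_of_index_two hX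
  have mulT {g h : G} : g * h ∈ T ↔ (g ∈ T ↔ h ∈ T) := Subgroup.mul_mem_iff_of_index_two hT
  have hcomm {g h : G} (hg : g ∈ X) (hh : h ∈ X) : Commute g h :=
    commute_of_sq_eq_one (hX2 _ hg) (hX2 _ hh) (hX2 _ (X.mul_mem hg hh))
  have hcentral {b : G} (hbX : b ∈ X) (hbT : b ∈ T) (g : G) : Commute g b := by
    by_cases hg : g ∈ X
    · exact hcomm hg hbX
    · have h1 : Commute (t * g) b := hcomm (mulX.2 (iff_of_false htX hg)) hbX
      have h2 : Commute t b := (memT.1 hbT).symm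
      have := h2.inv_left.mul_left h1
      rwa [inv_mul_cancel_left] at this
  rw [pow_two] at hx ht
  have hxinv : x⁻¹ = x := inv_eq_of_mul_eq_one_left hx
  have htinv : t⁻¹ = t := inv_eq_of_mul_eq_one_left ht
  set a := t * x with ha
  have haX : a ∉ X := fun h => htX ((mulX.1 h).2 hxX)
  have haT : a ∉ T := fun h => hxT ((mulT.1 h).1 htT)
  have hzX : a ^ 2 ∈ X := Subgroup.sq_mem_of_index_two hX a
  have hzT : a ^ 2 ∈ T := Subgroup.sq_mem_of_index_two hT a
  have hz1 : a ^ 2 ≠ 1 := fun h =>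
    hxt (commute_of_sq_eq_one (by rw [pow_two, ht]) (by rw [pow_two, hx]) h).symm
  have ha4 : a ^ 4 = 1 := by
    rw [show 4 = 2 * 2 from rfl, pow_mul]
    exact hX2 _ hzX
  obtain ⟨f, hf⟩ := DihedralGroup.exists_hom ha4 ht
    (by rw [ha, ← mul_assoc, ht, one_mul, mul_inv_rev, hxinv, htinv])
  let B : Subgroup G := X ⊓ T
  obtain ⟨E', hzE', hE'⟩ := exists_subgroup_complement_of_sq_eq_one (B := B)
    (fun b => Subtype.ext (hX2 _ b.2.1)) (z := ⟨a ^ 2, hzX, hzT⟩)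
    (fun h => hz1 (congrArg Subtype.val h))
  let E := E'.map B.subtype
  have hEB {e : G} (he : e ∈ E) : e ∈ X ∧ e ∈ T := by
    obtain ⟨b, -, rfl⟩ := he
    exact b.2
  have hzE : a ^ 2 ∉ E := by
    rintro ⟨b, hb, hba⟩
    exact hzE' ((Subtype.ext hba : b = ⟨a ^ 2, hzX, hzT⟩) ▸ hb)
  have hE {b : G} (hbX : b ∈ X) (hbT : b ∈ T) : b ∈ E ∨ a ^ 2 * b ∈ E :=
    (hE' ⟨b, hbX, hbT⟩).imp (fun h => ⟨_, h, rfl⟩) (fun h => ⟨_, h, rfl⟩)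
  obtain ⟨n, ⟨e⟩⟩ := exists_mulEquiv_pi_of_sq_eq_one (E := E)
    (fun b => Subtype.ext (hX2 _ (hEB b.2).1))
  let F : DihedralGroup 4 × E →* G :=
    f.noncommCoprod E.subtype fun d b => hcentral (hEB b.2).1 (hEB b.2).2 _
  have hF (d : DihedralGroup 4) (b : E) : F (d, b) = f d * b := rfl
  have hr (k : ℕ) : f (.r (k : ZMod 4)) = a ^ k := by simpa using (hf k).1
  have hsr (k : ℕ) : f (.sr (k : ZMod 4)) = t * a ^ k := by simpa using (hf k).2
  have ha3X : a ^ 3 ∉ X := fun h => haX ((mulX.1 (pow_succ a 2 ▸ h)).1 hzX)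
  have ha3T : a ^ 3 ∉ T := fun h => haT ((mulT.1 (pow_succ a 2 ▸ h)).1 hzT)
  have hker (d : DihedralGroup 4) (hd : f d ∈ E) : d = 1 := by
    have hdX := (hEB hd).1
    have hdT := (hEB hd).2
    rcases d with i | i <;> fin_cases i
    · rfl
    · exact absurd (pow_one a ▸ hr 1 ▸ hdX) haX
    · exact absurd (hr 2 ▸ hd) hzE
    · exact absurd (hr 3 ▸ hdX) ha3X
    · exact absurd ((mulX.1 (hsr 0 ▸ hdX)).2 (pow_zero a ▸ X.one_mem)) htX
    · exact absurd ((mulT.1 (hsr 1 ▸ hdT)).1 htT) (by rwa [pow_one])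
    · exact absurd ((mulX.1 (hsr 2 ▸ hdX)).2 hzX) htX
    · exact absurd ((mulT.1 (hsr 3 ▸ hdT)).1 htT) ha3T
  have hinj : Function.Injective F := by
    rw [injective_iff_map_eq_one]
    rintro ⟨d, b⟩ h
    rw [hF] at h
    have hd : d = 1 := hker d (by rw [eq_inv_of_mul_eq_one_left h]; exact E.inv_mem b.2)
    subst hd
    rw [map_one, one_mul] at h
    exact Prod.ext rfl (Subtype.ext h)
  have hsurj : Function.Surjective F := by
    rw [← MonoidHom.range_eq_top, Subgroup.eq_top_iff']
    have hfF (d : DihedralGroup 4) : f d ∈ F.range := ⟨(d, 1), by simp [hF]⟩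
    have haF : a ∈ F.range := by
      rw [← pow_one a, ← hr]; exact hfF _
    have htF : t ∈ F.range := by
      rw [← mul_one t, ← pow_zero a, ← hsr]; exact hfF _
    have hxF : x ∈ F.range := by
      have := F.range.mul_mem htF haF
      rwa [ha, ← mul_assoc, ht, one_mul] at this
    have hEF {b : G} (hb : b ∈ E) : b ∈ F.range := ⟨(1, ⟨b, hb⟩), by simp [hF]⟩
    have hBF {b : G} (hbX : b ∈ X) (hbT : b ∈ T) : b ∈ F.range := by
      rcases hE hbX hbT with h | h
      · exact hEF h
      · exact (F.range.mul_mem_cancel_left (F.range.pow_mem haF 2)).1 (hEF h)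
    intro g
    by_cases hgX : g ∈ X <;> by_cases hgT : g ∈ T
    · exact hBF hgX hgT
    · exact (F.range.mul_mem_cancel_left hxF).1
        (hBF (mulX.2 (iff_of_true hxX hgX)) (mulT.2 (iff_of_false hxT hgT)))
    · exact (F.range.mul_mem_cancel_left htF).1
        (hBF (mulX.2 (iff_of_false htX hgX)) (mulT.2 (iff_of_true htT hgT)))
    · exact (F.range.mul_mem_cancel_left haF).1
        (hBF (mulX.2 (iff_of_false haX hgX)) (mulT.2 (iff_of_false haT hgT)))
  exact ⟨n, ⟨(MulEquiv.ofBijective F ⟨hinj, hsurj⟩).symm.trans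
    ((MulEquiv.refl _).prodCongr e)⟩⟩

theorem exists_mulEquiv_dihedral_of_four_mul_numSqOne_eq {G : Type*} [Group G] [Fintype G]
    (h : 4 * numSqOne G = 3 * Nat.card G) :
    ∃ n : ℕ, Nonempty (G ≃* DihedralGroup 4 × (Fin n → Multiplicative (ZMod 2))) := by
  have hpos : 0 < Nat.card G := Nat.card_pos
  obtain ⟨x, hx, hxc⟩ : ∃ x : G, x ^ 2 = 1 ∧ x ∉ Subgroup.center G := by
    by_contra! hc
    have := numSqOne_eq_card_of_forall (sq_eq_one_of_forall_mem_center (by omega) hc)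
    omega
  obtain ⟨hX, hX2⟩ := centralizer_of_four_mul_numSqOne_eq h hx
    (mt mem_center_of_centralizer_eq_top hxc)
  obtain ⟨t, ht, htX⟩ : ∃ t : G, t ^ 2 = 1 ∧ t ∉ Subgroup.centralizer {x} := by
    by_contra! hc
    have h1 : numSqOne G ≤ Nat.card (Subgroup.centralizer {x}) := by
      rw [numSqOne_eq_card, ← card_filter_mem_subgroup]
      exact Finset.card_le_card fun y hy => by
        simp only [Finset.mem_filter, Finset.mem_univ, true_and] at hy ⊢
        exact hc y hy
    have h2 := (Subgroup.centralizer {x}).card_mul_index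
    rw [hX] at h2
    omega
  have hxt : ¬ Commute x t := fun hc => htX (Subgroup.mem_centralizer_singleton_iff.2 hc.symm)
  obtain ⟨hT, -⟩ := centralizer_of_four_mul_numSqOne_eq h ht fun hc => hxt
    (Subgroup.mem_centralizer_singleton_iff.1 (hc ▸ Subgroup.mem_top x))
  exact exists_mulEquiv_dihedral_of_centralizer hxt hx ht hX hT hX2

end Main

theorem stmt_16 (G : Type*) [Group G] [Fintype G] (h : ¬ ∀ g : G, g ^ 2 = 1) :
    (Nat.card G : ℤ) ≤ 8 * ((Nat.card G : ℤ) - (numCyclic G : ℤ)) ∧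
      ((Nat.card G : ℤ) = 8 * ((Nat.card G : ℤ) - (numCyclic G : ℤ)) ↔
        ∃ n : ℕ, Nonempty
          (G ≃* DihedralGroup 4 × (Fin n → Multiplicative (ZMod 2)))) := by
  have hle := two_mul_numCyclic_le (G := G)
  have hI := four_mul_numSqOne_le h
  refine ⟨by omega, fun heq => ?_, ?_⟩
  · exact exists_mulEquiv_dihedral_of_four_mul_numSqOne_eq (by omega)
  · rintro ⟨n, ⟨e⟩⟩
    have h4 : ∀ g : G, g ^ 4 = 1 := fun g => e.injective (by
      rw [map_pow, map_one]
      refine Prod.ext (dihedralGroup_four_pow_four _) ?_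
      exact (pow_mul (e g).2 2 2).trans (multiplicative_zmod_two_sq _))
    have hc := two_mul_numCyclic_eq h4
    have hcard : Nat.card G = 8 * Nat.card (Fin n → Multiplicative (ZMod 2)) := by
      rw [Nat.card_congr e.toEquiv, Nat.card_prod, DihedralGroup.nat_card]
    rw [numSqOne_congr e, numSqOne_prod, numSqOne_dihedralGroup_four,
      numSqOne_eq_card_of_forall multiplicative_zmod_two_sq] at hc
    omega
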